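/- Fix positive real constants σ and r. For M > 0, define a(M) = (1/2)·(√(1 + 8rσ²/M²) − 1), b(M) = (1−a(M))M/(2σ√r), and c(M) = (2σ√r·e^{−b(M)²})/(M√π) + φ(b(M)). Then the map M ↦ c(M) is strictly decreasing on (0, ∞). Consequently, in the regime rσ² < M², the equilibrium stopping threshold p = c(M)·l·√(πr)/(c(M)·l·√(πr) + σ) is strictly decreasing in M. -/

import Mathlib

/-- The Gauss error function `erf x = (2/√π) ∫₀ˣ e^{−t²} dt`. -/
noncomputable def erf (x : ℝ) : ℝ :=
  (2 / Real.sqrt Real.pi) * ∫ t in (0:ℝ)..x, Real.exp (-t ^ 2)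

lemma hasDerivAt_erf (x : ℝ) :
    HasDerivAt erf (2 / Real.sqrt Real.pi * Real.exp (-x ^ 2)) x := by
  have hcont : Continuous fun t : ℝ => Real.exp (-t ^ 2) := by fun_prop
  exact (hcont.integral_hasStrictDerivAt 0 x).hasDerivAt.const_mul _

lemma erf_pos {x : ℝ} (hx : 0 < x) : 0 < erf x := by
  have hcont : Continuous fun t : ℝ => Real.exp (-t ^ 2) := by fun_prop
  have hint : 0 < ∫ t in (0 : ℝ)..x, Real.exp (-t ^ 2) :=
    intervalIntegral.intervalIntegral_pos_of_pos (hcont.intervalIntegrable 0 x)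
      (fun t => Real.exp_pos _) hx
  have hpi : 0 < Real.sqrt Real.pi := Real.sqrt_pos.2 Real.pi_pos
  unfold erf
  positivity

/-- The function `b` in the rescaled variable `x = M / (σ √r)`. -/
noncomputable def scaledB (x : ℝ) : ℝ := (3 * x - Real.sqrt (x ^ 2 + 8)) / 4

/-- The function `c` in the rescaled variable `x = M / (σ √r)`. -/
noncomputable def scaledC (x : ℝ) : ℝ :=
  2 * Real.exp (-(scaledB x) ^ 2) / (x * Real.sqrt Real.pi) + erf (scaledB x)

lemma hasDerivAt_scaledB (x : ℝ) :
    HasDerivAt scaledB ((3 - x / Real.sqrt (x ^ 2 + 8)) / 4) x := by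
  have hsq : HasDerivAt (fun y : ℝ => y ^ 2 + 8) (2 * x) x := by
    simpa using (hasDerivAt_pow 2 x).add_const (8 : ℝ)
  have h := ((((hasDerivAt_id x).const_mul 3).sub
    (hsq.sqrt (by positivity))).div_const 4)
  refine h.congr_deriv ?_
  have : Real.sqrt (x ^ 2 + 8) ≠ 0 := by positivity
  field_simp

lemma hasDerivAt_scaledC {x : ℝ} (hx : 0 < x) :
    HasDerivAt scaledC
      (Real.exp (-(scaledB x) ^ 2) *
        (x ^ 3 + 6 * x - (x ^ 2 + 2) * Real.sqrt (x ^ 2 + 8)) /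
        (Real.sqrt Real.pi * x ^ 2 * Real.sqrt (x ^ 2 + 8))) x := by
  have hpi : Real.sqrt Real.pi ≠ 0 := (Real.sqrt_pos.2 Real.pi_pos).ne'
  have hB := hasDerivAt_scaledB x
  have h := (((hB.pow 2).neg.exp.const_mul 2).div
    ((hasDerivAt_id x).mul_const (Real.sqrt Real.pi)) (mul_ne_zero hx.ne' hpi)).add
    ((hasDerivAt_erf (scaledB x)).comp x hB)
  refine h.congr_deriv ?_
  have hR : Real.sqrt (x ^ 2 + 8) ≠ 0 := by positivity
  have hR2 : Real.sqrt (x ^ 2 + 8) ^ 2 = x ^ 2 + 8 := Real.sq_sqrt (by positivity)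
  have hx0 := hx.ne'
  simp only [Pi.neg_apply, Pi.pow_apply, id]
  generalize Real.exp (-(scaledB x) ^ 2) = E
  unfold scaledB
  generalize Real.sqrt (x ^ 2 + 8) = R at *
  field_simp
  push_cast
  linear_combination 3 * E * x * hR2

lemma strictAntiOn_scaledC : StrictAntiOn scaledC (Set.Ioi 0) := by
  refine strictAntiOn_of_deriv_neg (convex_Ioi 0)
    (fun x hx => (hasDerivAt_scaledC hx).continuousAt.continuousWithinAt) fun x hx => ?_
  rw [interior_Ioi] at hx
  have hx : 0 < x := hx
  rw [(hasDerivAt_scaledC hx).deriv]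
  have hpi : 0 < Real.sqrt Real.pi := Real.sqrt_pos.2 Real.pi_pos
  have hR2 : Real.sqrt (x ^ 2 + 8) ^ 2 = x ^ 2 + 8 := Real.sq_sqrt (by positivity)
  have hlt : x ^ 3 + 6 * x < (x ^ 2 + 2) * Real.sqrt (x ^ 2 + 8) := by
    refine lt_of_pow_lt_pow_left₀ 2 (by positivity) ?_
    rw [mul_pow, hR2]
    linarith
  exact div_neg_of_neg_of_pos (mul_neg_of_pos_of_neg (Real.exp_pos _) (by linarith))
    (by positivity)

lemma scaledC_pos {x : ℝ} (hx : 1 < x) : 0 < scaledC x := by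
  have hB : 0 < scaledB x := by
    have : Real.sqrt (x ^ 2 + 8) < 3 * x := (Real.sqrt_lt' (by linarith)).2 (by nlinarith)
    unfold scaledB
    linarith
  have hpi : 0 < Real.sqrt Real.pi := Real.sqrt_pos.2 Real.pi_pos
  have := erf_pos hB
  unfold scaledC
  positivity

/-- Fixing `σ, r > 0` (and `l > 0`), the map `M ↦ c(M)` is strictly decreasing
on `(0,∞)`; consequently, in the regime `rσ² < M²`, the equilibrium stopping threshold
`p(M) = c(M)l√(πr)/(c(M)l√(πr) + σ)` is strictly decreasing in `M`. -/
theorem stmt_17 (σ r l : ℝ) (hσ : 0 < σ) (hr : 0 < r) (hl : 0 < l)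
    (a b c p : ℝ → ℝ)
    (ha : ∀ M, a M = (1 / 2) * (Real.sqrt (1 + 8 * r * σ ^ 2 / M ^ 2) - 1))
    (hb : ∀ M, b M = (1 - a M) * M / (2 * σ * Real.sqrt r))
    (hc : ∀ M, c M = (2 * σ * Real.sqrt r * Real.exp (-(b M) ^ 2))
      / (M * Real.sqrt Real.pi) + erf (b M))
    (hp : ∀ M, p M = c M * l * Real.sqrt (Real.pi * r)
      / (c M * l * Real.sqrt (Real.pi * r) + σ)) :
    StrictAntiOn c (Set.Ioi 0) ∧
    (∀ M₁ M₂ : ℝ, 0 < M₁ → M₁ < M₂ → r * σ ^ 2 < M₁ ^ 2 → r * σ ^ 2 < M₂ ^ 2 →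
      p M₂ < p M₁) := by
  set s := σ * Real.sqrt r with hs
  have hs0 : 0 < s := by positivity
  have hs2 : s ^ 2 = r * σ ^ 2 := by rw [hs, mul_pow, Real.sq_sqrt hr.le]; ring
  have hpi : 0 < Real.sqrt Real.pi := Real.sqrt_pos.2 Real.pi_pos
  have hb' : ∀ M, 0 < M → b M = scaledB (M / s) := by
    intro M hM
    have hsqrt : M * Real.sqrt (1 + 8 * r * σ ^ 2 / M ^ 2) =
        s * Real.sqrt ((M / s) ^ 2 + 8) := by
      rw [← Real.sqrt_sq hM.le, ← Real.sqrt_sq hs0.le, ← Real.sqrt_mul (sq_nonneg _),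
        ← Real.sqrt_mul (sq_nonneg _), Real.sqrt_sq hM.le, Real.sqrt_sq hs0.le,
        show 8 * r * σ ^ 2 = 8 * s ^ 2 by rw [hs2]; ring]
      congr 1
      field_simp
    rw [hb, ha, scaledB, mul_assoc 2 σ, ← hs, div_eq_div_iff (by positivity) (by norm_num)]
    have hMs : M / s * s = M := div_mul_cancel₀ _ hs0.ne'
    linear_combination -2 * hsqrt - 6 * hMs
  have hc' : ∀ M, 0 < M → c M = scaledC (M / s) := by
    intro M hM
    rw [hc, hb' M hM, scaledC, mul_assoc 2 σ, ← hs]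
    field_simp
  have hanti : StrictAntiOn c (Set.Ioi 0) := by
    intro x hx y hy hxy
    rw [hc' x hx, hc' y hy]
    exact strictAntiOn_scaledC (div_pos hx hs0) (div_pos hy hs0)
      (div_lt_div_of_pos_right hxy hs0)
  have hc_pos : ∀ M, 0 < M → r * σ ^ 2 < M ^ 2 → 0 < c M := by
    intro M hM h
    rw [hc' M hM]
    refine scaledC_pos ((one_lt_div hs0).2 (lt_of_pow_lt_pow_left₀ 2 hM.le ?_))
    rwa [hs2]
  refine ⟨hanti, fun M₁ M₂ h₁ h₁₂ hr₁ hr₂ => ?_⟩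
  have h₂ := h₁.trans h₁₂
  have hk : 0 < Real.sqrt (Real.pi * r) := Real.sqrt_pos.2 (mul_pos Real.pi_pos hr)
  have hc₁ := hc_pos M₁ h₁ hr₁
  have hc₂ := hc_pos M₂ h₂ hr₂
  have hlt : c M₂ * l * Real.sqrt (Real.pi * r) < c M₁ * l * Real.sqrt (Real.pi * r) := by
    gcongr
    exact hanti h₁ h₂ h₁₂
  rw [hp, hp, div_lt_div_iff₀ (by positivity) (by positivity)]
  linarith [mul_lt_mul_of_pos_right hlt hσ]
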